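/- arXiv:2406.07660 — 2 statements merged into one kernel-verified Lean document; each statement's English description precedes it below -/
import Mathlib

section
/- Let w ∈ (0,1). For every x ∈ K and every 0 < r ≤ 1/9 one has ν_w(B(x,2r)) ≤ w^{−2}(1−w)^{−2} ν_w(B(x,r)), where B(x,r) denotes the open ball in ℝ centered at x of radius r. -/
open MeasureTheory Filter Set Metric
open scoped ENNReal Topology

noncomputable section

/-- The map `π : Σ = {0,1}^ℕ → ℝ` (with `false` representing the digit 0 and `true`
representing the digit 1, coordinates indexed from 0), `π(a) = ∑_{i} 2 aᵢ 3^{-(i+1)}`. -/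
def cantorPi (a : ℕ → Bool) : ℝ := ∑' i : ℕ, (if a i then 2 else 0) / 3 ^ (i + 1)

/-- The middle-third Cantor set `K = π(Σ)`. -/
def cantorK : Set ℝ := Set.range cantorPi

/-- The similar copy `K_a` of `K` determined by a finite binary string `a` of length `N`. -/
def cantorCyl {N : ℕ} (a : Fin N → Bool) : Set ℝ :=
  cantorPi '' {b : ℕ → Bool | ∀ i : Fin N, b i = a i}

/-- The number of zeros in the finite binary string `a`. -/
def zeros {N : ℕ} (a : Fin N → Bool) : ℕ := (Finset.univ.filter fun i => a i = false).card

/-- One step of the Bernoulli(w) shift map on `[0,1)`. -/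
def bernStep (w x : ℝ) : ℝ := if x < w then x / w else (x - w) / (1 - w)

/-- The Bernoulli(w) digit sequence of `x ∈ [0,1)`: digit `n` is `false` (i.e. 0)
iff the `n`-th iterate of the Bernoulli shift lies in `[0,w)`. -/
def bernDigits (w x : ℝ) : ℕ → Bool := fun n => decide (w ≤ (bernStep w)^[n] x)

/-- The Bernoulli product probability measure `ν_{w,Σ}` on `Σ = {0,1}^ℕ`, under which the
coordinates are i.i.d. with mass `w` on 0 (= `false`) and mass `1-w` on 1 (= `true`);
realized as the law of the Bernoulli(w) digit sequence of a uniform point of `[0,1)`. -/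
def bernMeasure (w : ℝ) : Measure (ℕ → Bool) :=
  Measure.map (bernDigits w) (volume.restrict (Set.Ico (0:ℝ) 1))

/-- The measure `ν_w = π_* ν_{w,Σ}` on `ℝ`, concentrated on `K`. -/
def nu (w : ℝ) : Measure ℝ := (bernMeasure w).map cantorPi

/-- The one-coordinate mass of the Bernoulli(w) measure: `w` on `false`, `1 - w` on `true`. -/
def bernMass (w : ℝ) (b : Bool) : ℝ := if b then 1 - w else w

theorem mul_one_sub_le_bernMass {w : ℝ} (hw : w ∈ Set.Ioo (0:ℝ) 1) (b : Bool) :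
    w * (1 - w) ≤ bernMass w b := by
  obtain ⟨h0, h1⟩ := hw
  cases b <;> simp only [bernMass] <;> norm_num <;> nlinarith

theorem bernMass_pos {w : ℝ} (hw : w ∈ Set.Ioo (0:ℝ) 1) (b : Bool) : 0 < bernMass w b :=
  (mul_pos hw.1 (sub_pos.2 hw.2)).trans_le (mul_one_sub_le_bernMass hw b)

theorem cantorPi_term_nonneg (a : ℕ → Bool) (i : ℕ) :
    (0:ℝ) ≤ (if a i then 2 else 0) / 3 ^ (i + 1) := by
  split_ifs <;> positivity

theorem cantorPi_term_le (a : ℕ → Bool) (i : ℕ) :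
    (if a i then (2:ℝ) else 0) / 3 ^ (i + 1) ≤ 2 / 3 * (1 / 3) ^ i := by
  have h : (2:ℝ) / 3 * (1 / 3) ^ i = 2 / 3 ^ (i + 1) := by
    rw [one_div, inv_pow, pow_succ]; field_simp
  rw [h]
  gcongr
  split_ifs <;> norm_num

theorem hasSum_two_thirds_geometric : HasSum (fun i : ℕ => (2:ℝ) / 3 * (1 / 3) ^ i) 1 := by
  have h := (hasSum_geometric_of_lt_one (r := (1:ℝ) / 3) (by norm_num) (by norm_num)).mul_left (2 / 3)
  norm_num at h ⊢
  exact h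

theorem summable_cantorPi (a : ℕ → Bool) :
    Summable fun i : ℕ => (if a i then (2:ℝ) else 0) / 3 ^ (i + 1) :=
  .of_nonneg_of_le (cantorPi_term_nonneg a) (cantorPi_term_le a)
    hasSum_two_thirds_geometric.summable

theorem cantorPi_nonneg (a : ℕ → Bool) : 0 ≤ cantorPi a :=
  tsum_nonneg (cantorPi_term_nonneg a)

theorem cantorPi_le_one (a : ℕ → Bool) : cantorPi a ≤ 1 := by
  rw [← hasSum_two_thirds_geometric.tsum_eq]
  exact (summable_cantorPi a).tsum_le_tsum (cantorPi_term_le a)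
    hasSum_two_thirds_geometric.summable

theorem cantorPi_eq_shift (a : ℕ → Bool) :
    cantorPi a = ((if a 0 then 2 else 0) + cantorPi fun i => a (i + 1)) / 3 := by
  rw [cantorPi, (summable_cantorPi a).tsum_eq_zero_add, cantorPi, add_div, ← tsum_div_const]
  congr 1
  · simp
  · refine tsum_congr fun i => ?_
    rw [div_div, ← pow_succ]

theorem measurable_cantorPi : Measurable cantorPi := by
  refine Continuous.measurable ?_
  refine continuous_tsum (fun i => ?_) hasSum_two_thirds_geometric.summable fun i a => ?_
  · exact (continuous_of_discreteTopology (f := fun b : Bool =>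
      (if b then (2:ℝ) else 0) / 3 ^ (i + 1))).comp (continuous_apply i)
  · rw [Real.norm_of_nonneg (cantorPi_term_nonneg a i)]
    exact cantorPi_term_le a i

theorem abs_cantorPi_sub_le {n : ℕ} {a b : ℕ → Bool} (h : ∀ i < n, b i = a i) :
    |cantorPi b - cantorPi a| ≤ (1 / 3) ^ n := by
  induction n generalizing a b with
  | zero =>
    rw [pow_zero, abs_le]
    constructor <;> linarith [cantorPi_nonneg a, cantorPi_le_one a, cantorPi_nonneg b,
      cantorPi_le_one b]
  | succ n ih =>
    have hs := ih (a := fun i => a (i + 1)) (b := fun i => b (i + 1))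
      fun i hi => h (i + 1) (by omega)
    rw [cantorPi_eq_shift a, cantorPi_eq_shift b, h 0 (by omega), pow_succ]
    rw [abs_le] at hs ⊢
    constructor <;> linarith [hs.1, hs.2]

theorem eq_of_abs_cantorPi_sub_lt {n : ℕ} {a b : ℕ → Bool}
    (h : |cantorPi b - cantorPi a| < (1 / 3) ^ n) : ∀ i < n, b i = a i := by
  induction n generalizing a b with
  | zero => intro i hi; omega
  | succ n ih =>
    rw [cantorPi_eq_shift a, cantorPi_eq_shift b, pow_succ, abs_lt] at h
    have hp : ((1:ℝ) / 3) ^ n ≤ 1 := pow_le_one₀ (by norm_num) (by norm_num)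
    have ha := cantorPi_nonneg fun i => a (i + 1)
    have ha' := cantorPi_le_one fun i => a (i + 1)
    have hb := cantorPi_nonneg fun i => b (i + 1)
    have hb' := cantorPi_le_one fun i => b (i + 1)
    obtain ⟨h1, h2⟩ := h
    have h0 : b 0 = a 0 := by
      clear ih
      generalize ((1:ℝ) / 3) ^ n = q at *
      cases ha0 : a 0 <;> cases hb0 : b 0 <;> simp [ha0, hb0] at h1 h2 ⊢ <;> linarith
    rw [h0] at h1 h2
    have hs := ih (a := fun i => a (i + 1)) (b := fun i => b (i + 1))
      (abs_lt.2 ⟨by linarith, by linarith⟩)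
    intro i hi
    cases i with
    | zero => exact h0
    | succ i => exact hs i (by omega)

theorem measurable_bernStep (w : ℝ) : Measurable (bernStep w) :=
  Measurable.ite measurableSet_Iio (by fun_prop) (by fun_prop)

theorem measurable_bernDigits (w : ℝ) : Measurable (bernDigits w) := by
  refine measurable_pi_lambda _ fun n => ?_
  refine measurable_to_bool ?_
  have : (fun t => bernDigits w t n) ⁻¹' {true} = (bernStep w)^[n] ⁻¹' Set.Ici w := by
    ext t; simp [bernDigits]
  rw [this]
  exact (measurable_bernStep w).iterate n measurableSet_Ici

theorem bernDigits_zero (w t : ℝ) : bernDigits w t 0 = decide (w ≤ t) := rfl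

theorem bernDigits_succ (w t : ℝ) (n : ℕ) :
    bernDigits w t (n + 1) = bernDigits w (bernStep w t) n := rfl

theorem volume_bernDigits_cylinder {w : ℝ} (hw : w ∈ Set.Ioo (0:ℝ) 1) (n : ℕ) (a : ℕ → Bool) :
    volume {t ∈ Set.Ico (0:ℝ) 1 | ∀ i < n, bernDigits w t i = a i} =
      ENNReal.ofReal (∏ i ∈ Finset.range n, bernMass w (a i)) := by
  obtain ⟨h0, h1⟩ := hw
  have h1' : 0 < 1 - w := sub_pos.2 h1
  induction n generalizing a with
  | zero =>
    have : {t ∈ Set.Ico (0:ℝ) 1 | ∀ i < 0, bernDigits w t i = a i} = Set.Ico 0 1 := by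
      ext t; simp
    rw [this]
    simp
  | succ n ih =>
    rw [Finset.prod_range_succ', mul_comm]
    cases ha : a 0 with
    | false =>
      have : {t ∈ Set.Ico (0:ℝ) 1 | ∀ i < n + 1, bernDigits w t i = a i} =
          (fun t => t * w⁻¹) ⁻¹'
            {t ∈ Set.Ico (0:ℝ) 1 | ∀ i < n, bernDigits w t i = a (i + 1)} := by
        ext t
        simp only [Set.mem_ofPred_eq, Set.mem_preimage, Set.mem_Ico, Nat.forall_lt_succ_left,
          bernDigits_zero, bernDigits_succ, ha, decide_eq_false_iff_not, not_le, ← div_eq_mul_inv,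
          le_div_iff₀ h0, div_lt_one h0, zero_mul]
        constructor
        · rintro ⟨⟨ht, -⟩, htw, h⟩
          exact ⟨⟨ht, htw⟩, by simpa [bernStep, htw] using h⟩
        · rintro ⟨⟨ht, htw⟩, h⟩
          exact ⟨⟨ht, htw.trans h1⟩, htw, by simpa [bernStep, htw] using h⟩
      rw [this, Real.volume_preimage_mul_right (inv_ne_zero h0.ne'), ih, inv_inv, abs_of_pos h0,
        ENNReal.ofReal_mul (by simp [bernMass, h0.le])]
      simp [bernMass]
    | true =>
      have : {t ∈ Set.Ico (0:ℝ) 1 | ∀ i < n + 1, bernDigits w t i = a i} =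
          (fun t => t + -w) ⁻¹' ((fun t => t * (1 - w)⁻¹) ⁻¹'
            {t ∈ Set.Ico (0:ℝ) 1 | ∀ i < n, bernDigits w t i = a (i + 1)}) := by
        ext t
        simp only [Set.mem_ofPred_eq, Set.mem_preimage, Set.mem_Ico, Nat.forall_lt_succ_left,
          bernDigits_zero, bernDigits_succ, ha, decide_eq_true_eq, ← div_eq_mul_inv, ← sub_eq_add_neg,
          le_div_iff₀ h1', div_lt_one h1', zero_mul, sub_nonneg, sub_lt_sub_iff_right]
        constructor
        · rintro ⟨⟨-, ht⟩, htw, h⟩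
          exact ⟨⟨htw, ht⟩, by simpa [bernStep, htw.not_gt] using h⟩
        · rintro ⟨⟨htw, ht⟩, h⟩
          exact ⟨⟨h0.le.trans htw, ht⟩, htw, by simpa [bernStep, htw.not_gt] using h⟩
      rw [this, measure_preimage_add_right, Real.volume_preimage_mul_right (inv_ne_zero h1'.ne'),
        ih, inv_inv, abs_of_pos h1', ENNReal.ofReal_mul (by simp [bernMass, h1.le])]
      simp [bernMass]

theorem measurableSet_cylinder (n : ℕ) (a : ℕ → Bool) :
    MeasurableSet {b : ℕ → Bool | ∀ i < n, b i = a i} := by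
  have : {b : ℕ → Bool | ∀ i < n, b i = a i} =
      ⋂ i, ⋂ _ : i < n, (fun b : ℕ → Bool => b i) ⁻¹' {a i} := by
    ext b; simp
  rw [this]
  exact .iInter fun i => .iInter fun _ => measurable_pi_apply i (measurableSet_singleton _)

theorem bernMeasure_cylinder {w : ℝ} (hw : w ∈ Set.Ioo (0:ℝ) 1) (n : ℕ) (a : ℕ → Bool) :
    bernMeasure w {b | ∀ i < n, b i = a i} =
      ENNReal.ofReal (∏ i ∈ Finset.range n, bernMass w (a i)) := by
  rw [bernMeasure, Measure.map_apply (measurable_bernDigits w) (measurableSet_cylinder n a),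
    Measure.restrict_apply (measurable_bernDigits w (measurableSet_cylinder n a)),
    ← volume_bernDigits_cylinder hw, Set.inter_comm]
  rfl

theorem bernMeasure_cylinder_le {w : ℝ} (hw : w ∈ Set.Ioo (0:ℝ) 1) (n : ℕ) (a : ℕ → Bool) :
    bernMeasure w {b | ∀ i < n, b i = a i} ≤
      ENNReal.ofReal (w⁻¹ ^ 2 * (1 - w)⁻¹ ^ 2) * bernMeasure w {b | ∀ i < n + 2, b i = a i} := by
  have h0 := hw.1
  have h1 : 0 < 1 - w := sub_pos.2 hw.2
  rw [bernMeasure_cylinder hw, bernMeasure_cylinder hw, ← ENNReal.ofReal_mul (by positivity)]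
  refine ENNReal.ofReal_le_ofReal ?_
  rw [Finset.prod_range_succ, Finset.prod_range_succ]
  have hP : 0 ≤ ∏ i ∈ Finset.range n, bernMass w (a i) :=
    Finset.prod_nonneg fun i _ => (bernMass_pos hw _).le
  have hpq : (w * (1 - w)) * (w * (1 - w)) ≤ bernMass w (a n) * bernMass w (a (n + 1)) :=
    mul_le_mul (mul_one_sub_le_bernMass hw _) (mul_one_sub_le_bernMass hw _)
      (by positivity) (bernMass_pos hw _).le
  calc ∏ i ∈ Finset.range n, bernMass w (a i)
      = w⁻¹ ^ 2 * (1 - w)⁻¹ ^ 2 *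
          ((∏ i ∈ Finset.range n, bernMass w (a i)) * ((w * (1 - w)) * (w * (1 - w)))) := by
        field_simp
    _ ≤ _ := by
        rw [mul_assoc (∏ i ∈ Finset.range n, bernMass w (a i))]
        gcongr

/-- Triadic scale of a radius `r ≤ 1/9`. -/
theorem exists_triadic_scale {r : ℝ} (hr0 : 0 < r) (hr : r ≤ 1 / 9) :
    ∃ n : ℕ, (1 / 3 : ℝ) ^ (n + 2) < r ∧ 2 * r < (1 / 3) ^ n := by
  classical
  have hex : ∃ m : ℕ, (1 / 3 : ℝ) ^ m < r := exists_pow_lt_of_lt_one hr0 (by norm_num)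
  obtain ⟨m, hm, hmin⟩ : ∃ m : ℕ, (1 / 3 : ℝ) ^ m < r ∧ ∀ k < m, r ≤ (1 / 3 : ℝ) ^ k :=
    ⟨Nat.find hex, Nat.find_spec hex, fun k hk => not_lt.1 (Nat.find_min hex hk)⟩
  match m with
  | 0 => norm_num at hm; linarith
  | 1 => norm_num at hm; linarith
  | n + 2 =>
    refine ⟨n, hm, ?_⟩
    have h := hmin (n + 1) (by omega)
    have hp : (0:ℝ) < (1 / 3) ^ n := by positivity
    rw [pow_succ] at h
    linarith

/-- For `w ∈ (0,1)`, `x ∈ K` and `0 < r ≤ 1/9`,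
`ν_w(B(x,2r)) ≤ w⁻²(1-w)⁻² ν_w(B(x,r))`. -/
theorem nu_doubling_explicit (w : ℝ) (hw : w ∈ Set.Ioo (0:ℝ) 1) (x : ℝ) (hx : x ∈ cantorK)
    (r : ℝ) (hr0 : 0 < r) (hr : r ≤ 1 / 9) :
    nu w (Metric.ball x (2 * r)) ≤
      ENNReal.ofReal (w⁻¹ ^ 2 * (1 - w)⁻¹ ^ 2) * nu w (Metric.ball x r) := by
  obtain ⟨a, rfl⟩ := hx
  obtain ⟨n, hn, hn'⟩ := exists_triadic_scale hr0 hr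
  rw [nu, Measure.map_apply measurable_cantorPi measurableSet_ball,
    Measure.map_apply measurable_cantorPi measurableSet_ball]
  calc bernMeasure w (cantorPi ⁻¹' ball (cantorPi a) (2 * r))
      ≤ bernMeasure w {b | ∀ i < n, b i = a i} := by
        refine measure_mono fun b hb => ?_
        rw [Set.mem_preimage, mem_ball, Real.dist_eq] at hb
        exact eq_of_abs_cantorPi_sub_lt (hb.trans hn')
    _ ≤ _ := bernMeasure_cylinder_le hw n a
    _ ≤ _ := by
        gcongr
        intro b hb
        rw [Set.mem_preimage, mem_ball, Real.dist_eq]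
        exact (abs_cantorPi_sub_le hb).trans_lt hn
end
end

section
/- Let J ⊂ ℝ be a compact interval of positive length, let f : J → ℝ be Lipschitz, and let A, B ⊂ J be measurable sets of positive Lebesgue measure. Then |(1/|A|)∫_A f(t) dt − (1/|B|)∫_B f(t) dt| ≤ ∫_J Lip[f](t) dt, where Lip[f](t) := limsup_{s→t, s∈J, s≠t} |f(s)−f(t)|/|s−t| and |A| denotes the Lebesgue measure of A (the right-hand side interpreted as an upper Lebesgue integral). -/
open MeasureTheory Filter Set Metric
open scoped ENNReal Topology

noncomputable section

/-- The pointwise Lipschitz constant of `f` at `t` relative to the set `J`: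
`Lip[f](t) = limsup_{s → t, s ∈ J, s ≠ t} |f(s) - f(t)| / |s - t|`. -/
def pLip (f : ℝ → ℝ) (J : Set ℝ) (t : ℝ) : ℝ :=
  Filter.limsup (fun s => |f s - f t| / |s - t|) (nhdsWithin t (J \ {t}))

/-- If `f` has derivative `f'` at `t` within `J`, and `t` is an accumulation point of `J`, then
the pointwise Lipschitz constant of `f` at `t` is `|f'|`. -/
theorem HasDerivWithinAt.pLip_eq {f : ℝ → ℝ} {J : Set ℝ} {t f' : ℝ}
    [(𝓝[J \ {t}] t).NeBot] (h : HasDerivWithinAt f f' J t) : pLip f J t = |f'| := by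
  refine Tendsto.limsup_eq ((hasDerivWithinAt_iff_tendsto_slope.1 h).abs.congr fun s => ?_)
  rw [slope_def_field, abs_div]

theorem pLip_Icc_eq_abs_deriv {a b t : ℝ} {f : ℝ → ℝ} (ht : t ∈ Ioo a b)
    (h : DifferentiableAt ℝ f t) : pLip f (Icc a b) t = |deriv f t| := by
  have : (𝓝[Icc a b \ {t}] t).NeBot := by
    rw [sdiff_eq, nhdsWithin_inter_of_mem
      (mem_nhdsWithin_of_mem_nhds (Icc_mem_nhds ht.1 ht.2))]
    infer_instance
  exact h.hasDerivAt.hasDerivWithinAt.pLip_eq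

/-- For an absolutely continuous function, the upper integral of the pointwise Lipschitz constant
is the integral of the absolute value of the derivative. -/
theorem AbsolutelyContinuousOnInterval.toReal_lintegral_pLip_eq {a b : ℝ} (hab : a ≤ b) {f : ℝ → ℝ}
    (hf : AbsolutelyContinuousOnInterval f a b) :
    (∫⁻ t in Icc a b, ENNReal.ofReal (pLip f (Icc a b) t)).toReal =
      ∫ t in Icc a b, ‖deriv f t‖ := by
  have hint : IntegrableOn (deriv f) (Icc a b) :=
    (intervalIntegrable_iff_integrableOn_Icc_of_le hab).1 hf.intervalIntegrable_deriv
  rw [integral_norm_eq_lintegral_enorm hint.aestronglyMeasurable, ← restrict_Ioo_eq_restrict_Icc]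
  congr 1
  refine lintegral_congr_ae ?_
  filter_upwards [ae_restrict_mem measurableSet_Ioo,
    ae_restrict_of_ae hf.ae_differentiableAt] with t ht hd
  rw [pLip_Icc_eq_abs_deriv ht (hd (uIcc_of_le hab ▸ Ioo_subset_Icc_self ht)),
    ← Real.norm_eq_abs, ofReal_norm]

theorem LipschitzOnWith.abs_sub_le_lintegral_pLip {a b : ℝ} {f : ℝ → ℝ}
    {L : NNReal} (hf : LipschitzOnWith L f (Icc a b)) {x y : ℝ} (hx : x ∈ Icc a b)
    (hy : y ∈ Icc a b) :
    |f y - f x| ≤ (∫⁻ t in Icc a b, ENNReal.ofReal (pLip f (Icc a b) t)).toReal := by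
  have hab : a ≤ b := hx.1.trans hx.2
  have hac : AbsolutelyContinuousOnInterval f a b :=
    LipschitzOnWith.absolutelyContinuousOnInterval ((uIcc_of_le hab).symm ▸ hf)
  have hint : IntegrableOn (deriv f) (Icc a b) :=
    (intervalIntegrable_iff_integrableOn_Icc_of_le hab).1 hac.intervalIntegrable_deriv
  have hsub : uIcc x y ⊆ Icc a b := uIcc_subset_Icc hx hy
  rw [hac.toReal_lintegral_pLip_eq hab,
    ← (hf.mono hsub).absolutelyContinuousOnInterval.integral_deriv_eq_sub]
  exact intervalIntegral.norm_integral_le_integral_norm_uIoc.trans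
    (setIntegral_mono_set hint.norm (ae_of_all _ fun _ => norm_nonneg _)
      (uIoc_subset_uIcc.trans hsub).eventuallyLE)

/-- For a Lipschitz function `f` on a compact interval `J = [a,b]` of positive length and
measurable sets `A, B ⊆ J` of positive Lebesgue measure, the difference of the averages of
`f` over `A` and over `B` is at most the (upper) integral over `J` of the pointwise
Lipschitz constant of `f`. -/
theorem abs_average_sub_average_le_lintegral_pLip (a b : ℝ) (hab : a < b) (f : ℝ → ℝ)
    (L : NNReal) (hf : LipschitzOnWith L f (Set.Icc a b)) (A B : Set ℝ)
    (hA : MeasurableSet A) (hB : MeasurableSet B) (hAJ : A ⊆ Set.Icc a b)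
    (hBJ : B ⊆ Set.Icc a b) (hA0 : 0 < volume A) (hB0 : 0 < volume B) :
    |(⨍ t in A, f t) - ⨍ t in B, f t| ≤
      (∫⁻ t in Set.Icc a b, ENNReal.ofReal (pLip f (Set.Icc a b) t)).toReal := by
  have hint {S : Set ℝ} (hS : S ⊆ Icc a b) : IntegrableOn f S :=
    hf.continuousOn.integrableOn_Icc.mono_set hS
  have hfin {S : Set ℝ} (hS : S ⊆ Icc a b) : volume S ≠ ∞ :=
    measure_ne_top_of_subset hS measure_Icc_lt_top.ne
  obtain ⟨x, hx, hxA⟩ := exists_le_setAverage hA0.ne' (hfin hAJ) (hint hAJ)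
  obtain ⟨x', hx', hxA'⟩ := exists_setAverage_le hA0.ne' (hfin hAJ) (hint hAJ)
  obtain ⟨y, hy, hyB⟩ := exists_le_setAverage hB0.ne' (hfin hBJ) (hint hBJ)
  obtain ⟨y', hy', hyB'⟩ := exists_setAverage_le hB0.ne' (hfin hBJ) (hint hBJ)
  have h₁ := (le_abs_self _).trans (hf.abs_sub_le_lintegral_pLip (hBJ hy) (hAJ hx'))
  have h₂ := (le_abs_self _).trans (hf.abs_sub_le_lintegral_pLip (hAJ hx) (hBJ hy'))
  rw [abs_le]
  constructor <;> linarith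
end
end
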